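/- arXiv:1312.4446 — 2 statements merged into one kernel-verified Lean document; each statement's English description precedes it below -/
import Mathlib

section
/- For every integer s ≤ −1, H₀(s+1, 1) + H₀(s+1, −1) + H₀(s−1, 1) + H₀(s−1, −1) = 4·H₀(s, 0). -/
/-- The discrete harmonic measure of the tip of the slit in the slit lattice plane,
`H₀(s,k) = (1/(2π)) ∫_{−π}^{π} (cos θ/(1+|sin θ|))^{|k|} e^{−isθ} (1−e^{−2iθ})^{−1/2} dθ`. -/
noncomputable def H0 (s k : ℤ) : ℂ :=
  (1 / (2 * (Real.pi : ℂ))) *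
    ∫ θ in (-Real.pi)..Real.pi,
      ((Real.cos θ / (1 + |Real.sin θ|) : ℝ) : ℂ) ^ k.natAbs *
        Complex.exp (-Complex.I * (s : ℂ) * (θ : ℂ)) *
        ((1 : ℂ) - Complex.exp (-2 * Complex.I * (θ : ℂ))) ^ (-(1 / 2) : ℂ)

open Complex in
theorem H0aux_circle (n : ℕ) :
    ∫ θ in (-Real.pi)..Real.pi, Complex.exp (((n + 1 : ℕ) : ℂ) * (Complex.I * (θ : ℂ))) *
      ((1 : ℂ) - Complex.exp (2 * Complex.I * (θ : ℂ))) ^ (1 / 2 : ℂ) = 0 := by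
  have hre : ∀ z : ℂ, ‖z‖ ≤ 1 → (z ^ 2).re ≤ 1 := fun z hz =>
    (Complex.re_le_norm _).trans (by rw [norm_pow]; exact pow_le_one₀ (norm_nonneg _) hz)
  have hre' : ∀ z : ℂ, ‖z‖ < 1 → (z ^ 2).re < 1 := fun z hz =>
    (Complex.re_le_norm _).trans_lt (by
      rw [norm_pow]; exact pow_lt_one₀ (norm_nonneg _) hz (by norm_num))
  have key : (∮ z in C(0, 1), z ^ n * (1 - z ^ 2) ^ (1 / 2 : ℂ)) = 0 := by
    refine circleIntegral_eq_zero_of_differentiable_on_off_countable zero_le_one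
      Set.countable_empty ?_ ?_
    · intro z hz
      have hz : ‖z‖ ≤ 1 := by simpa using hz
      apply ContinuousAt.continuousWithinAt
      refine ContinuousAt.mul (by fun_prop) ?_
      have h1 : ContinuousAt (fun x : ℂ => x ^ (1 / 2 : ℂ)) (1 - z ^ 2) :=
        continuousAt_cpow_const_of_re_pos (Or.inl (by
          have := hre z hz
          rw [sub_re, one_re]; linarith)) (by norm_num)
      exact ContinuousAt.comp (f := fun z : ℂ => 1 - z ^ 2) h1 (by fun_prop)
    · intro z hz
      have hz : ‖z‖ < 1 := by simpa using hz.1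
      refine DifferentiableAt.mul (by fun_prop) ?_
      refine DifferentiableAt.cpow (by fun_prop) (by fun_prop) (Or.inl ?_)
      have := hre' z hz
      rw [sub_re, one_re]; linarith
  set F : ℝ → ℂ := fun θ => Complex.exp (((n + 1 : ℕ) : ℂ) * (Complex.I * (θ : ℂ))) *
      ((1 : ℂ) - Complex.exp (2 * Complex.I * (θ : ℂ))) ^ (1 / 2 : ℂ) with hF
  have hE : ∀ θ : ℝ, F θ = circleMap 0 1 θ ^ (n + 1) * (1 - circleMap 0 1 θ ^ 2) ^ (1 / 2 : ℂ) := by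
    intro θ
    simp only [hF, circleMap, ofReal_one, one_mul, zero_add, ← Complex.exp_nat_mul]
    congr 2
    · congr 1; ring
    · congr 2; push_cast; ring
  have hP : Function.Periodic F (2 * Real.pi) := by
    intro θ
    rw [hE, hE, periodic_circleMap 0 1 θ]
  have h2 := hP.intervalIntegral_add_eq (-Real.pi) 0
  rw [show -Real.pi + 2 * Real.pi = Real.pi by ring, zero_add] at h2
  rw [h2]
  rw [circleIntegral] at key
  have h3 : ∀ θ : ℝ, deriv (circleMap 0 1) θ • (circleMap 0 1 θ ^ n *
      (1 - circleMap 0 1 θ ^ 2) ^ (1 / 2 : ℂ)) = I * F θ := by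
    intro θ
    rw [hE, deriv_circleMap, smul_eq_mul]; ring
  simp only [h3, intervalIntegral.integral_const_mul] at key
  simpa using key

theorem H0aux_norm (θ : ℝ) :
    ‖(1 : ℂ) - Complex.exp (-2 * Complex.I * (θ : ℂ))‖ = 2 * |Real.sin θ| := by
  have : (1 : ℂ) - Complex.exp (-2 * Complex.I * (θ : ℂ)) =
      Complex.exp (((-θ : ℝ) : ℂ) * Complex.I) * (2 * Complex.I * (Real.sin θ : ℂ)) := by
    rw [Complex.ofReal_sin, Complex.sin]
    have h1 : Complex.exp (-2 * Complex.I * (θ : ℂ)) =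
      Complex.exp (((-θ : ℝ) : ℂ) * Complex.I) * Complex.exp (-(θ : ℂ) * Complex.I) := by
      rw [← Complex.exp_add]; congr 1; push_cast; ring
    have h2 : (1 : ℂ) =
      Complex.exp (((-θ : ℝ) : ℂ) * Complex.I) * Complex.exp ((θ : ℂ) * Complex.I) := by
      rw [← Complex.exp_add, ← Complex.exp_zero]; congr 1; push_cast; ring
    rw [h1]
    conv_lhs => rw [h2]
    linear_combination (-Complex.exp (((-θ : ℝ) : ℂ) * Complex.I) *
      (Complex.exp (-(θ : ℂ) * Complex.I) - Complex.exp ((θ : ℂ) * Complex.I))) * Complex.I_sq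
  rw [this, norm_mul, Complex.norm_exp_ofReal_mul_I, norm_mul, norm_mul, Complex.norm_I,
    Complex.norm_real, Real.norm_eq_abs]
  norm_num

theorem H0aux_pt (θ : ℝ) :
    ((2 * |Real.sin θ| : ℝ) : ℂ) * ((1 : ℂ) - Complex.exp (-2 * Complex.I * (θ : ℂ))) ^ (-(1 / 2) : ℂ)
      = ((1 : ℂ) - Complex.exp (2 * Complex.I * (θ : ℂ))) ^ (1 / 2 : ℂ) := by
  have hn := H0aux_norm θ
  have hc : (starRingEnd ℂ) ((1 : ℂ) - Complex.exp (-2 * Complex.I * (θ : ℂ))) =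
      (1 : ℂ) - Complex.exp (2 * Complex.I * (θ : ℂ)) := by
    rw [map_sub, map_one, ← Complex.exp_conj]
    simp [show (starRingEnd ℂ) (2 : ℂ) = 2 from Complex.conj_ofNat 2]
  have hre : 0 ≤ ((1 : ℂ) - Complex.exp (-2 * Complex.I * (θ : ℂ))).re := by
    have h : ‖Complex.exp (-2 * Complex.I * (θ : ℂ))‖ = 1 := by
      rw [Complex.norm_exp]; simp
    have := Complex.re_le_norm (Complex.exp (-2 * Complex.I * (θ : ℂ)))
    rw [Complex.sub_re, Complex.one_re]; linarith
  rw [← hn, ← hc]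
  generalize (1 : ℂ) - Complex.exp (-2 * Complex.I * (θ : ℂ)) = a at *
  by_cases ha : a = 0
  · subst ha; simp
  have harg : a.arg ≠ Real.pi := by
    intro h
    rw [Complex.arg_eq_pi_iff] at h
    linarith [h.1]
  have hne : a ^ (1 / 2 : ℂ) ≠ 0 := by simp [Complex.cpow_eq_zero_iff, ha]
  have h12 : (starRingEnd ℂ) (1 / 2 : ℂ) = 1 / 2 := by
    have : (1 / 2 : ℂ) = ((1 / 2 : ℝ) : ℂ) := by push_cast; rfl
    rw [this, Complex.conj_ofReal]
  rw [Complex.conj_cpow _ _ harg, Complex.cpow_neg, h12, ← div_eq_mul_inv, div_eq_iff hne,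
    mul_comm, Complex.mul_conj, Complex.normSq_eq_norm_sq, ← norm_pow, ← Complex.cpow_nat_mul]
  norm_num

theorem H0aux_int : IntervalIntegrable (fun θ : ℝ =>
    ((1 : ℂ) - Complex.exp (-2 * Complex.I * (θ : ℂ))) ^ (-(1 / 2) : ℂ)) MeasureTheory.volume
    (-Real.pi) Real.pi := by
  have hP : Function.Periodic (fun θ : ℝ =>
    ((1 : ℂ) - Complex.exp (-2 * Complex.I * (θ : ℂ))) ^ (-(1 / 2) : ℂ)) Real.pi := by
    intro θ
    simp only
    congr 2
    rw [← Complex.exp_periodic.sub_eq]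
    push_cast
    rw [show -2 * Complex.I * ((θ : ℂ) + Real.pi) =
      -2 * Complex.I * (θ : ℂ) - 2 * Real.pi * Complex.I by ring,
      Complex.exp_periodic.sub_eq, Complex.exp_periodic.sub_eq]
  refine hP.intervalIntegrable Real.pi_ne_zero (t := -(Real.pi / 2)) ?_ _ _
  rw [show -(Real.pi / 2) + Real.pi = Real.pi / 2 by ring]
  have h0 : IntervalIntegrable (fun x : ℝ => (x : ℂ) ^ ((-(1 / 2) : ℝ) : ℂ)) MeasureTheory.volume
      (-(Real.pi / 2)) (Real.pi / 2) :=
    intervalIntegral.intervalIntegrable_cpow' (by rw [Complex.ofReal_re]; norm_num)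
  refine h0.mono_fun ?_ ?_
  · apply Measurable.aestronglyMeasurable
    fun_prop
  · have hmem : ∀ᵐ x ∂(MeasureTheory.volume.restrict (Set.uIoc (-(Real.pi / 2)) (Real.pi / 2))),
        x ∈ Set.uIoc (-(Real.pi / 2)) (Real.pi / 2) :=
      MeasureTheory.ae_restrict_mem measurableSet_uIoc
    filter_upwards [hmem] with x hx
    have hpi := Real.pi_pos
    rw [Set.uIoc_of_le (by linarith)] at hx
    rw [show (-(1 / 2) : ℂ) = ((-(1 / 2) : ℝ) : ℂ) by push_cast; rfl,
      Complex.norm_cpow_real, Complex.norm_cpow_real, H0aux_norm, Complex.norm_real,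
      Real.norm_eq_abs]
    by_cases hx0 : x = 0
    · subst hx0; simp
    have hb : |x| ≤ 2 * |Real.sin x| := by
      have h1 := Real.mul_abs_le_abs_sin (x := x) (abs_le.2 ⟨hx.1.le, hx.2⟩)
      have h2 : 1 / 2 ≤ 2 / Real.pi := by
        rw [div_le_div_iff₀ (by norm_num) hpi]; linarith [Real.pi_le_four]
      nlinarith [abs_nonneg x]
    exact Real.rpow_le_rpow_of_nonpos (abs_pos.2 hx0) hb (by norm_num)

theorem H0_discrete_harmonic_on_axis (s : ℤ) (hs : s ≤ -1) :
    H0 (s + 1) 1 + H0 (s + 1) (-1) + H0 (s - 1) 1 + H0 (s - 1) (-1) = 4 * H0 s 0 := by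
  obtain ⟨n, hn⟩ : ∃ n : ℕ, s = -((n + 1 : ℕ) : ℤ) := ⟨(-1 - s).toNat, by omega⟩
  have hcir := H0aux_circle n
  have hI : ∀ (k : ℕ) (t : ℤ), IntervalIntegrable (fun θ : ℝ =>
      ((Real.cos θ / (1 + |Real.sin θ|) : ℝ) : ℂ) ^ k *
        Complex.exp (-Complex.I * (t : ℂ) * (θ : ℂ)) *
        ((1 : ℂ) - Complex.exp (-2 * Complex.I * (θ : ℂ))) ^ (-(1 / 2) : ℂ))
      MeasureTheory.volume (-Real.pi) Real.pi := by
    intro k t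
    refine H0aux_int.continuousOn_mul (Continuous.continuousOn ?_)
    have : Continuous fun θ : ℝ => Real.cos θ / (1 + |Real.sin θ|) :=
      Real.continuous_cos.div (by fun_prop) (fun θ => by positivity)
    fun_prop
  have e1 : H0 (s + 1) (-1) = H0 (s + 1) 1 := by simp [H0]
  have e2 : H0 (s - 1) (-1) = H0 (s - 1) 1 := by simp [H0]
  rw [e1, e2]
  have hmain := (intervalIntegral.integral_add (hI 1 (s + 1)) (hI 1 (s - 1)))
  have hpt : ∀ θ : ℝ, ((Real.cos θ / (1 + |Real.sin θ|) : ℝ) : ℂ) ^ 1 *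
        Complex.exp (-Complex.I * ((s + 1 : ℤ) : ℂ) * (θ : ℂ)) *
        ((1 : ℂ) - Complex.exp (-2 * Complex.I * (θ : ℂ))) ^ (-(1 / 2) : ℂ) +
      ((Real.cos θ / (1 + |Real.sin θ|) : ℝ) : ℂ) ^ 1 *
        Complex.exp (-Complex.I * ((s - 1 : ℤ) : ℂ) * (θ : ℂ)) *
        ((1 : ℂ) - Complex.exp (-2 * Complex.I * (θ : ℂ))) ^ (-(1 / 2) : ℂ) =
      2 * (((Real.cos θ / (1 + |Real.sin θ|) : ℝ) : ℂ) ^ 0 *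
        Complex.exp (-Complex.I * (s : ℂ) * (θ : ℂ)) *
        ((1 : ℂ) - Complex.exp (-2 * Complex.I * (θ : ℂ))) ^ (-(1 / 2) : ℂ)) -
      Complex.exp (((n + 1 : ℕ) : ℂ) * (Complex.I * (θ : ℂ))) *
      ((1 : ℂ) - Complex.exp (2 * Complex.I * (θ : ℂ))) ^ (1 / 2 : ℂ) := by
    intro θ
    rw [← H0aux_pt θ]
    have a1 : Complex.exp (((n + 1 : ℕ) : ℂ) * (Complex.I * (θ : ℂ))) =
        Complex.exp (-Complex.I * (s : ℂ) * (θ : ℂ)) := by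
      rw [hn]; congr 1; push_cast; ring
    have a2 : Complex.exp (-Complex.I * ((s + 1 : ℤ) : ℂ) * (θ : ℂ)) =
        Complex.exp (-Complex.I * (s : ℂ) * (θ : ℂ)) * Complex.exp (-(θ : ℂ) * Complex.I) := by
      rw [← Complex.exp_add]; congr 1; push_cast; ring
    have a3 : Complex.exp (-Complex.I * ((s - 1 : ℤ) : ℂ) * (θ : ℂ)) =
        Complex.exp (-Complex.I * (s : ℂ) * (θ : ℂ)) * Complex.exp ((θ : ℂ) * Complex.I) := by
      rw [← Complex.exp_add]; congr 1; push_cast; ring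
    have a4 : Complex.exp ((θ : ℂ) * Complex.I) + Complex.exp (-(θ : ℂ) * Complex.I) =
        2 * (Real.cos θ : ℂ) := by
      rw [Complex.ofReal_cos, Complex.two_cos]
    have a5 : Real.cos θ / (1 + |Real.sin θ|) * Real.cos θ = 1 - |Real.sin θ| := by
      have : 0 < 1 + |Real.sin θ| := by positivity
      field_simp
      have h1 := Real.sin_sq_add_cos_sq θ
      have h2 := sq_abs (Real.sin θ)
      nlinarith
    have a6 : ((Real.cos θ / (1 + |Real.sin θ|) : ℝ) : ℂ) * (Real.cos θ : ℂ) =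
        1 - ((|Real.sin θ| : ℝ) : ℂ) := by
      rw [← Complex.ofReal_mul, a5]; push_cast; rfl
    rw [a1, a2, a3, Complex.ofReal_mul]
    generalize ((1 : ℂ) - Complex.exp (-2 * Complex.I * (θ : ℂ))) ^ (-(1 / 2) : ℂ) = w
    generalize Complex.exp (-Complex.I * (s : ℂ) * (θ : ℂ)) = E
    generalize ((Real.cos θ / (1 + |Real.sin θ|) : ℝ) : ℂ) = f at *
    push_cast
    push_cast at a4 a6
    linear_combination (f * E * w) * a4 + 2 * E * w * a6
  have hF2 : IntervalIntegrable (fun θ : ℝ =>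
      Complex.exp (((n + 1 : ℕ) : ℂ) * (Complex.I * (θ : ℂ))) *
      ((1 : ℂ) - Complex.exp (2 * Complex.I * (θ : ℂ))) ^ (1 / 2 : ℂ))
      MeasureTheory.volume (-Real.pi) Real.pi := by
    simp only [← H0aux_pt, ← mul_assoc]
    refine H0aux_int.continuousOn_mul (Continuous.continuousOn ?_)
    fun_prop
  simp only [hpt] at hmain
  rw [intervalIntegral.integral_sub ((hI 0 s).const_mul 2) hF2, hcir,
    intervalIntegral.integral_const_mul] at hmain
  simp only [H0, Int.natAbs_one, Int.natAbs_zero]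
  linear_combination (-2 * (1 / (2 * (Real.pi : ℂ)))) * hmain
end

section
/- For every integer s ≥ 1, ∫_{−π}^{π} exp(i·s·θ) · |sin θ| · (1 − exp(−2iθ))^(−1/2) dθ = 0. -/
theorem aux_norm (θ : ℝ) : ‖(1:ℂ) - Complex.exp (2 * Complex.I * θ)‖ = 2 * |Real.sin θ| := by
  have h : (1:ℂ) - Complex.exp (2 * Complex.I * θ)
      = Complex.exp (θ * Complex.I) * (-2 * Complex.I * (Real.sin θ : ℝ)) := by
    have e : Complex.exp (2 * Complex.I * θ) = Complex.exp (θ * Complex.I) ^ 2 := by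
      rw [← Complex.exp_nat_mul]; congr 1; push_cast; ring
    have := Complex.sin_sq_add_cos_sq (θ : ℂ)
    rw [e, Complex.exp_mul_I, Complex.ofReal_sin]
    linear_combination (-1) * this + (Complex.sin θ ^ 2) * Complex.I_sq
  rw [h, norm_mul, Complex.norm_exp_ofReal_mul_I, norm_mul, Complex.norm_real]
  simp

theorem aux_point (θ : ℝ) : ((|Real.sin θ| : ℝ) : ℂ) *
        ((1 : ℂ) - Complex.exp (-2 * Complex.I * (θ : ℂ))) ^ (-(1 / 2) : ℂ)
      = (1/2) * ((1 : ℂ) - Complex.exp (2 * Complex.I * (θ : ℂ))) ^ (1 / 2 : ℂ) := by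
  have hn := aux_norm θ
  have hre : 0 ≤ ((1 : ℂ) - Complex.exp (2 * Complex.I * (θ : ℂ))).re := by
    have := Complex.re_le_norm (Complex.exp (2 * Complex.I * (θ : ℂ)))
    have h2 : ‖Complex.exp (2 * Complex.I * (θ : ℂ))‖ = 1 := by
      rw [Complex.norm_exp]; simp
    simp only [Complex.sub_re, Complex.one_re]; linarith
  have hc : (1 : ℂ) - Complex.exp (-2 * Complex.I * (θ : ℂ))
      = (starRingEnd ℂ) ((1 : ℂ) - Complex.exp (2 * Complex.I * (θ : ℂ))) := by
    rw [map_sub, ← Complex.exp_conj]; simp [Complex.conj_ofNat]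
  rw [hc]
  generalize (1 : ℂ) - Complex.exp (2 * Complex.I * (θ : ℂ)) = w at *
  have hs : |Real.sin θ| = ‖w‖ / 2 := by linarith
  rw [hs]
  by_cases hw : w = 0
  · subst hw; simp
  have hcw : (starRingEnd ℂ) w ≠ 0 := by simpa using hw
  have ha : w.arg ≠ Real.pi := by
    intro h
    have := Complex.arg_eq_pi_iff.1 h
    linarith [this.1]
  have hlog : Complex.log ((starRingEnd ℂ) w) = (starRingEnd ℂ) (Complex.log w) :=
    Complex.log_conj _ ha
  have hsum : Complex.log w + (starRingEnd ℂ) (Complex.log w) = 2 * (Real.log ‖w‖ : ℝ) := by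
    rw [Complex.add_conj, Complex.log_re]; push_cast; ring
  have hnorm : ((‖w‖ : ℝ) : ℂ) = Complex.exp (Real.log ‖w‖ : ℝ) := by
    rw [← Complex.ofReal_exp, Real.exp_log (norm_pos_iff.2 hw)]
  rw [Complex.cpow_def_of_ne_zero hcw, Complex.cpow_def_of_ne_zero hw, hlog]
  push_cast [hnorm]
  rw [div_mul_eq_mul_div, ← Complex.exp_add, div_eq_inv_mul, ← one_div]
  congr 2
  linear_combination (-1/2) * hsum

theorem aux_cauchy (n : ℕ) :
    (∮ z in C(0, 1), z ^ n * ((1:ℂ) - z ^ 2) ^ (1 / 2 : ℂ)) = 0 := by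
  have hre : ∀ z : ℂ, (z ^ 2).re ≤ ‖z‖ ^ 2 := fun z => by
    have := Complex.re_le_norm (z ^ 2); rwa [norm_pow] at this
  apply Complex.circleIntegral_eq_zero_of_differentiable_on_off_countable zero_le_one
    Set.countable_empty
  · intro z hz
    have hz : ‖z‖ ≤ 1 := by simpa using hz
    apply ContinuousAt.continuousWithinAt
    apply ContinuousAt.mul (by fun_prop)
    have h1 : ContinuousAt (fun x : ℂ => x ^ (1 / 2 : ℂ)) (1 - z ^ 2) := by
      apply Complex.continuousAt_cpow_const_of_re_pos
      · left
        have := hre z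
        simp only [Complex.sub_re, Complex.one_re]
        nlinarith [norm_nonneg z]
      · norm_num
    exact ContinuousAt.comp (f := fun z : ℂ => 1 - z ^ 2) h1 (by fun_prop)
  · intro z hz
    have hz : ‖z‖ < 1 := by simpa using hz.1
    apply DifferentiableAt.mul (by fun_prop)
    apply DifferentiableAt.cpow_const (by fun_prop)
    left
    have := hre z
    simp only [Complex.sub_re, Complex.one_re]
    nlinarith [norm_nonneg z]

theorem integral_sin_abs_mul_cpow_vanishes (s : ℤ) (hs : 1 ≤ s) :
    (∫ θ in (-Real.pi)..Real.pi,
      Complex.exp (Complex.I * (s : ℂ) * (θ : ℂ)) * ((|Real.sin θ| : ℝ) : ℂ) *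
        ((1 : ℂ) - Complex.exp (-2 * Complex.I * (θ : ℂ))) ^ (-(1 / 2) : ℂ)) = 0 := by
  obtain ⟨n, rfl⟩ : ∃ n : ℕ, s = n + 1 := ⟨(s - 1).toNat, by omega⟩
  have hpt : ∀ θ : ℝ, Complex.exp (Complex.I * (((n : ℤ) + 1 : ℤ) : ℂ) * (θ : ℂ)) *
      ((|Real.sin θ| : ℝ) : ℂ) *
        ((1 : ℂ) - Complex.exp (-2 * Complex.I * (θ : ℂ))) ^ (-(1 / 2) : ℂ)
      = (1 / (2 * Complex.I)) * (deriv (circleMap 0 1) θ •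
        (circleMap 0 1 θ ^ n * ((1:ℂ) - circleMap 0 1 θ ^ 2) ^ (1 / 2 : ℂ))) := by
    intro θ
    rw [mul_assoc, aux_point, deriv_circleMap]
    have e1 : Complex.exp (Complex.I * (((n : ℤ) + 1 : ℤ) : ℂ) * (θ : ℂ))
        = circleMap 0 1 θ ^ (n + 1) := by
      simp only [circleMap, Complex.ofReal_one, one_mul, zero_add]
      rw [← Complex.exp_nat_mul]; congr 1; push_cast; ring
    have e2 : Complex.exp (2 * Complex.I * (θ : ℂ)) = circleMap 0 1 θ ^ 2 := by
      simp only [circleMap, Complex.ofReal_one, one_mul, zero_add]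
      rw [← Complex.exp_nat_mul]; congr 1; push_cast; ring
    rw [e1, e2, smul_eq_mul]
    have := Complex.I_ne_zero
    field_simp
    ring
  simp_rw [hpt]
  rw [intervalIntegral.integral_const_mul]
  have hper : Function.Periodic (fun θ : ℝ => deriv (circleMap 0 1) θ •
        (circleMap 0 1 θ ^ n * ((1:ℂ) - circleMap 0 1 θ ^ 2) ^ (1 / 2 : ℂ))) (2 * Real.pi) := by
    intro θ
    simp only [deriv_circleMap, periodic_circleMap (0:ℂ) 1 θ]
  have h := hper.intervalIntegral_add_eq (-Real.pi) 0
  have hp : -Real.pi + 2 * Real.pi = Real.pi := by ring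
  rw [hp, zero_add] at h
  rw [h]
  have := aux_cauchy n
  rw [circleIntegral] at this
  rw [this, mul_zero]
end
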